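/- arXiv:2002.01024 — 2 statements merged into one kernel-verified Lean document; each statement's English description precedes it below -/
import Mathlib

section
/- Let t be a squarefree positive integer and let P = (X, Y) be a rational point on E_t : Y² = X³ − t²X with Y ≠ 0. Write X = p/q with p an integer, q a positive integer, and gcd(p, q) = 1, and let H = max(|p|, q). Let (a, b, c) = ((X² − t²)/Y, 2tX/Y, (X² + t²)/Y). If (a₀, b₀, c₀) is a primitive Pythagorean triple and λ is a positive rational with {a₀, b₀} = {λ·|a|, λ·|b|} and c₀ = λ·|c|, then c₀ ≥ H/(2t). -/
/-- A primitive integer triple that is a positive rational multiple of another integer triple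
divides it by a natural number. -/
lemma exists_nat_mul_eq_of_primitive {a b c u v w : ℕ} (hprim : Nat.gcd (Nat.gcd a b) c = 1)
    {μ : ℚ} (hμ : 0 < μ) (ha : (a : ℚ) = μ * u) (hb : (b : ℚ) = μ * v) (hc : (c : ℚ) = μ * w) :
    ∃ g : ℕ, u = g * a ∧ v = g * b ∧ w = g * c := by
  obtain ⟨m, hm⟩ : ∃ m : ℕ, μ.num = m := ⟨μ.num.toNat, by have := Rat.num_pos.2 hμ; omega⟩
  have hμm : μ * μ.den = m := by rw [Rat.mul_den_eq_num, hm]; simp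
  have hcop : Nat.Coprime m μ.den := by simpa [hm] using μ.reduced
  have key : ∀ x y : ℕ, (x : ℚ) = μ * y → μ.den * x = m * y := by
    intro x y h
    have : (μ.den : ℚ) * x = m * y := by rw [h, ← hμm]; ring
    exact_mod_cast this
  have hdvd : ∀ x y : ℕ, (x : ℚ) = μ * y → m ∣ x := fun x y h =>
    hcop.dvd_of_dvd_mul_left (Dvd.intro _ (key x y h).symm)
  have hm1 : m = 1 := by
    rw [← Nat.dvd_one, ← hprim]
    exact Nat.dvd_gcd (Nat.dvd_gcd (hdvd _ _ ha) (hdvd _ _ hb)) (hdvd _ _ hc)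
  subst hm1
  refine ⟨μ.den, ?_, ?_, ?_⟩
  · simpa using (key _ _ ha).symm
  · simpa using (key _ _ hb).symm
  · simpa using (key _ _ hc).symm

/-- If `c` is the quotient of `p² + t²q²` by a common divisor with `p² - t²q²`, where `p` and `q`
are coprime, then `max |p| q ≤ 2tc`. -/
lemma max_natAbs_le_of_common_dvd {t q c g : ℕ} {p : ℤ} (ht : 0 < t)
    (hcop : p.natAbs.Coprime q) (hw : p ^ 2 + (t * q : ℤ) ^ 2 = g * c)
    (hu : (g : ℤ) ∣ p ^ 2 - (t * q : ℤ) ^ 2) :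
    max p.natAbs q ≤ 2 * t * c := by
  obtain ⟨n, hn⟩ : ∃ n, n = p.natAbs := ⟨_, rfl⟩
  have hpn : p ^ 2 = (n : ℤ) ^ 2 := by rw [hn, Int.natAbs_sq]
  rw [← hn] at hcop ⊢
  rw [hpn] at hw hu
  have hw' : n ^ 2 + (t * q) ^ 2 = g * c := by exact_mod_cast hw
  have hgw : (g : ℤ) ∣ (n : ℤ) ^ 2 + (t * q : ℤ) ^ 2 := Dvd.intro _ hw.symm
  have h1 : g ∣ 2 * n ^ 2 := by
    zify
    refine (dvd_add hgw hu).trans (dvd_of_eq ?_)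
    ring
  have h2 : g ∣ 2 * (t * q) ^ 2 := by
    zify
    refine (dvd_sub hgw hu).trans (dvd_of_eq ?_)
    ring
  have h3 : g ∣ 2 * Nat.gcd n t ^ 2 := by
    have := Nat.dvd_gcd h1 h2
    rwa [Nat.gcd_mul_left, Nat.pow_gcd_pow, hcop.symm.gcd_mul_right_cancel_right] at this
  obtain ⟨d, hd⟩ : ∃ d, d = Nat.gcd n t := ⟨_, rfl⟩
  have hdpos : 0 < d := hd ▸ Nat.gcd_pos_of_pos_right _ ht
  obtain ⟨r, hr⟩ : d ∣ n := hd ▸ Nat.gcd_dvd_left n t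
  obtain ⟨s, hs⟩ : d ∣ t := hd ▸ Nat.gcd_dvd_right n t
  rw [← hd] at h3
  have hg : g ≤ 2 * d ^ 2 := Nat.le_of_dvd (by positivity) h3
  have hspos : 0 < s := Nat.pos_of_mul_pos_left (hs ▸ ht)
  have h4 : d ^ 2 * (r ^ 2 + (s * q) ^ 2) ≤ d ^ 2 * (2 * c) := by
    calc d ^ 2 * (r ^ 2 + (s * q) ^ 2) = g * c := by rw [← hw', hr, hs]; ring
      _ ≤ 2 * d ^ 2 * c := Nat.mul_le_mul_right _ hg
      _ = _ := by ring
  have h5 := Nat.le_of_mul_le_mul_left h4 (by positivity)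
  have h6 : t * (r ^ 2 + (s * q) ^ 2) ≤ 2 * t * c := by
    calc _ ≤ t * (2 * c) := Nat.mul_le_mul_left _ h5
      _ = _ := by ring
  refine max_le (le_trans ?_ h6) (le_trans ?_ h6)
  · calc n = d * r := hr
      _ ≤ t * r ^ 2 := Nat.mul_le_mul (hs ▸ Nat.le_mul_of_pos_right d hspos)
          (Nat.le_self_pow two_ne_zero r)
      _ ≤ _ := Nat.mul_le_mul_left _ (Nat.le_add_right _ _)
  · calc q ≤ s * q := Nat.le_mul_of_pos_left q hspos
      _ ≤ (s * q) ^ 2 := Nat.le_self_pow two_ne_zero _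
      _ ≤ r ^ 2 + (s * q) ^ 2 := Nat.le_add_left _ _
      _ ≤ _ := Nat.le_mul_of_pos_left _ ht

/-- If `(X, Y)` is a rational point on `Y² = X³ − t²X` with `Y ≠ 0`, where `t` is a
squarefree positive integer, and `(a₀, b₀, c₀)` is a primitive Pythagorean triple similar
to the triangle `((X² − t²)/Y, 2tX/Y, (X² + t²)/Y)` (up to signs), then the hypotenuse
`c₀` satisfies `c₀ ≥ H/(2t)`, where `H = max(|p|, q)` is the naive height of `X = p/q`
in lowest terms. -/
theorem hypotenuse_ge_height_div (t : ℕ) (hsf : Squarefree t) (ht : 0 < t)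
    (X Y : ℚ) (hY : Y ≠ 0) (heq : Y ^ 2 = X ^ 3 - (t : ℚ) ^ 2 * X)
    (a₀ b₀ c₀ : ℕ) (ha₀ : 0 < a₀) (hb₀ : 0 < b₀) (hc₀ : 0 < c₀)
    (hpyth : a₀ ^ 2 + b₀ ^ 2 = c₀ ^ 2) (hprim : Nat.gcd (Nat.gcd a₀ b₀) c₀ = 1)
    (lam : ℚ) (hlam : 0 < lam)
    (hlegs : ({(a₀ : ℚ), (b₀ : ℚ)} : Set ℚ) =
      ({lam * |(X ^ 2 - (t : ℚ) ^ 2) / Y|, lam * |2 * (t : ℚ) * X / Y|} : Set ℚ))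
    (hhyp : (c₀ : ℚ) = lam * |(X ^ 2 + (t : ℚ) ^ 2) / Y|) :
    (c₀ : ℚ) ≥ (max X.num.natAbs X.den : ℚ) / (2 * t) := by
  have hq : (X.den : ℚ) ≠ 0 := by exact_mod_cast X.den_ne_zero
  have hX : X = X.num / X.den := (Rat.num_div_den X).symm
  generalize hp : X.num = p at *
  generalize hqd : X.den = q at *
  have hcop : p.natAbs.Coprime q := hp ▸ hqd ▸ X.reduced
  have hscale : ∀ x : ℚ, lam * |x / Y| = lam / |Y| / q ^ 2 * |x * q ^ 2| := by
    intro x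
    rw [abs_div, abs_mul, abs_of_nonneg (sq_nonneg (q : ℚ))]
    field_simp
  have hμ : 0 < lam / |Y| / (q : ℚ) ^ 2 := by positivity
  have e1 : |(X ^ 2 - (t : ℚ) ^ 2) * q ^ 2| = ((p ^ 2 - (t * q : ℤ) ^ 2).natAbs : ℕ) := by
    rw [Nat.cast_natAbs, Int.cast_abs]
    congr 1
    push_cast
    rw [hX]
    field_simp
  have e2 : |2 * (t : ℚ) * X * q ^ 2| = (((2 * t * p * q : ℤ).natAbs : ℕ) : ℚ) := by
    rw [Nat.cast_natAbs, Int.cast_abs]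
    congr 1
    push_cast
    rw [hX]
    field_simp
  have e3 : |(X ^ 2 + (t : ℚ) ^ 2) * q ^ 2| = ((p ^ 2 + (t * q : ℤ) ^ 2).natAbs : ℕ) := by
    rw [Nat.cast_natAbs, Int.cast_abs]
    congr 1
    push_cast
    rw [hX]
    field_simp
  rw [hscale, hscale, e1, e2] at hlegs
  rw [hscale, e3] at hhyp
  obtain ⟨g, hu, hw⟩ : ∃ g : ℕ, g ∣ (p ^ 2 - (t * q : ℤ) ^ 2).natAbs ∧
      (p ^ 2 + (t * q : ℤ) ^ 2).natAbs = g * c₀ := by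
    rcases Set.pair_eq_pair_iff.1 hlegs with ⟨h1, h2⟩ | ⟨h1, h2⟩
    · obtain ⟨g, h, -, h'⟩ := exists_nat_mul_eq_of_primitive hprim hμ h1 h2 hhyp
      exact ⟨g, Dvd.intro _ h.symm, h'⟩
    · obtain ⟨g, -, h, h'⟩ := exists_nat_mul_eq_of_primitive hprim hμ h1 h2 hhyp
      exact ⟨g, Dvd.intro _ h.symm, h'⟩
  have hw' : p ^ 2 + (t * q : ℤ) ^ 2 = g * c₀ := by
    rw [← Int.natAbs_of_nonneg (by positivity : 0 ≤ p ^ 2 + (t * q : ℤ) ^ 2), hw]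
    push_cast
    rfl
  have hmain := max_natAbs_le_of_common_dvd ht hcop hw' (Int.natCast_dvd.2 hu)
  rw [ge_iff_le, div_le_iff₀ (by positivity)]
  have : ((max p.natAbs q : ℕ) : ℚ) ≤ ((2 * t * c₀ : ℕ) : ℚ) := by exact_mod_cast hmain
  push_cast at this ⊢
  linarith
end

section
/- The number 113 is not a congruent number: there do not exist positive rational numbers a, b, c with a² + b² = c² and ab/2 = 113. -/
namespace NotCongruent113

instance : Fact (Nat.Prime 113) := ⟨by norm_num⟩

/-- The imaginary unit. -/
def im : GaussianInt := ⟨0, 1⟩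

theorem im_sq : im ^ 2 = -1 := by decide

theorem eq_add_mul_im (x : GaussianInt) : x = (x.re : GaussianInt) + x.im * im := by
  ext <;> simp [im]

theorem add_mul_im_ext {a b c d : ℤ} (h : (a : GaussianInt) + b * im = c + d * im) :
    a = c ∧ b = d := by
  simpa [im, Zsqrtd.ext_iff] using h

theorem irreducible_of_norm_prime {x : GaussianInt} (h : x.norm.natAbs.Prime) :
    Irreducible x := by
  refine ⟨fun hu => ?_, fun a b hab => ?_⟩
  · rw [Zsqrtd.norm_eq_one_iff.mpr hu] at h
    exact Nat.not_prime_one h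
  · rw [hab, Zsqrtd.norm_mul, Int.natAbs_mul, Nat.prime_mul_iff] at h
    rw [← Zsqrtd.norm_eq_one_iff, ← Zsqrtd.norm_eq_one_iff]
    tauto

theorem isUnit_eq {x : GaussianInt} (h : IsUnit x) : ∃ k : ℕ, x = im ^ k := by
  rw [← Zsqrtd.norm_eq_one_iff] at h
  obtain ⟨a, b⟩ := x
  have h1 : a ^ 2 + b ^ 2 = 1 := by
    simp only [Zsqrtd.norm] at h
    have : 0 ≤ a * a - -1 * b * b := by nlinarith [sq_nonneg a, sq_nonneg b]
    have h2 : a * a - -1 * b * b = 1 := by omega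
    linarith
  have ha : a ≤ 1 := by nlinarith [sq_nonneg b]
  have ha' : -1 ≤ a := by nlinarith [sq_nonneg b]
  have hb : b ≤ 1 := by nlinarith [sq_nonneg a]
  have hb' : -1 ≤ b := by nlinarith [sq_nonneg a]
  interval_cases a <;> interval_cases b <;> first | omega | skip
  · exact ⟨2, by decide⟩
  · exact ⟨3, by decide⟩
  · exact ⟨1, by decide⟩
  · exact ⟨0, by decide⟩

/-- `x` is a square up to factors which are units or primes above `2` and `113`. -/
def SquareUpToBad (x : GaussianInt) : Prop :=
  ∃ (e₁ e₂ e₃ e₄ : ℕ) (n : GaussianInt),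
    x = im ^ e₁ * (1 + im) ^ e₂ * (7 + 8 * im) ^ e₃ * (7 - 8 * im) ^ e₄ * n ^ 2

theorem prime_dvd_226 {q : GaussianInt} (hq : Prime q) (h : q ∣ 226) :
    ∃ (e₁ e₂ e₃ e₄ : ℕ), q = im ^ e₁ * (1 + im) ^ e₂ * (7 + 8 * im) ^ e₃ * (7 - 8 * im) ^ e₄ := by
  have key : ∀ g : GaussianInt, g.norm.natAbs.Prime → q ∣ g → ∃ k : ℕ, q = im ^ k * g := by
    intro g hg hqg
    obtain ⟨u, hu⟩ := (hq.irreducible.associated_of_dvd (irreducible_of_norm_prime hg) hqg).symm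
    obtain ⟨k, hk⟩ := isUnit_eq u.isUnit
    exact ⟨k, by rw [← hu, hk, mul_comm]⟩
  have hfac : (226 : GaussianInt) =
      -im * ((1 + im) * (1 + im)) * ((7 + 8 * im) * (7 - 8 * im)) := by decide
  rw [hfac] at h
  rcases hq.dvd_or_dvd h with h | h
  · rcases hq.dvd_or_dvd h with h | h
    · refine absurd (isUnit_of_dvd_unit h ?_) hq.not_isUnit
      exact IsUnit.of_mul_eq_one im (by decide)
    · obtain ⟨k, hk⟩ := key (1 + im) (by norm_num [Zsqrtd.norm, im])
        ((hq.dvd_or_dvd h).elim id id)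
      exact ⟨k, 1, 0, 0, by simp [hk]⟩
  · rcases hq.dvd_or_dvd h with h | h
    · obtain ⟨k, hk⟩ := key _ (by norm_num [Zsqrtd.norm, im]) h
      exact ⟨k, 0, 1, 0, by simp [hk]⟩
    · obtain ⟨k, hk⟩ := key _ (by norm_num [Zsqrtd.norm, im]) h
      exact ⟨k, 0, 0, 1, by simp [hk]⟩

theorem squareUpToBad_of_mul_eq {a : GaussianInt} (ha : a ≠ 0) : ∀ {b c k : GaussianInt},
    (∀ q, Prime q → q ∣ c → q ∣ 226) → (∀ q, Prime q → q ∣ a → q ∣ b → q ∣ 226) →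
    a * b = c * k ^ 2 → SquareUpToBad a := by
  revert ha
  induction a using (wellFounded_dvdNotUnit (α := GaussianInt)).induction with | _ a ih
  intro ha b c k hc hab h
  by_cases hu : IsUnit a
  · obtain ⟨j, hj⟩ := isUnit_eq hu
    exact ⟨j, 0, 0, 0, 1, by simp [hj]⟩
  obtain ⟨q, hq, a', rfl⟩ := WfDvdMonoid.exists_irreducible_factor hu ha
  have hq := hq.prime
  have hq0 := hq.ne_zero
  have ha' : a' ≠ 0 := right_ne_zero_of_mul ha
  by_cases hq2 : q ∣ 226
  · obtain ⟨f₁, f₂, f₃, f₄, n, hn⟩ := ih a' ⟨ha', q, hq.not_isUnit, mul_comm _ _⟩ ha'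
      (b := q * b) (c := c) (k := k) hc (fun r hr h1 h2 => by
        rcases hr.dvd_or_dvd h2 with h2 | h2
        · exact h2.trans hq2
        · exact hab r hr (h1.mul_left _) h2) (by rw [← h]; ring)
    obtain ⟨e₁, e₂, e₃, e₄, he⟩ := prime_dvd_226 hq hq2
    exact ⟨e₁ + f₁, e₂ + f₂, e₃ + f₃, e₄ + f₄, n, by rw [hn, he]; ring⟩
  · have hqb : ¬ q ∣ b := fun hb => hq2 (hab q hq (dvd_mul_right _ _) hb)
    have hqc : ¬ q ∣ c := fun hb => hq2 (hc q hq hb)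
    have hqk : q ∣ k := by
      have : q ∣ c * k ^ 2 := by rw [← h, mul_assoc]; exact dvd_mul_right _ _
      exact hq.dvd_of_dvd_pow ((hq.dvd_or_dvd this).resolve_left hqc)
    obtain ⟨k', rfl⟩ := hqk
    have h1 : a' * b = q * (c * k' ^ 2) := mul_left_cancel₀ hq0 (by linear_combination h)
    obtain ⟨a'', rfl⟩ := (hq.dvd_or_dvd (h1 ▸ dvd_mul_right q _ : q ∣ a' * b)).resolve_right hqb
    have ha'' : a'' ≠ 0 := right_ne_zero_of_mul ha'
    obtain ⟨f₁, f₂, f₃, f₄, n, hn⟩ := ih a'' ⟨ha'', q * q, fun hu => hq.not_isUnit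
        (isUnit_of_mul_isUnit_left hu), by ring⟩ ha'' (b := b) (c := c) (k := k') hc
      (fun r hr h1 h2 => hab r hr ((h1.mul_left _).mul_left _) h2)
      (mul_left_cancel₀ hq0 (by linear_combination h1))
    exact ⟨f₁, f₂, f₃, f₄, q * n, by rw [hn]; ring⟩

theorem SquareUpToBad.isSquare_map {a : GaussianInt} (h : SquareUpToBad a)
    (φ : GaussianInt →+* ZMod 113) : IsSquare (φ a) := by
  obtain ⟨e₁, e₂, e₃, e₄, n, rfl⟩ := h
  have hi : φ im = 15 ∨ φ im = -15 := by
    rw [← sq_eq_sq_iff_eq_or_eq_neg, ← map_pow, im_sq, map_neg, map_one]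
    decide
  simp only [map_mul, map_pow, map_add, map_sub, map_one, map_ofNat]
  refine ((((IsSquare.pow _ ?_).mul (IsSquare.pow _ ?_)).mul (IsSquare.pow _ ?_)).mul
    (IsSquare.pow _ ?_)).mul (IsSquare.sq _) <;> rcases hi with hi | hi <;> rw [hi] <;> decide

/-- If `(x₀, y₀, z₀)` and `(x, y, z)` are points of the conic `A x² = B y² + C z²`, then the
tangent form at the first point takes a value at the second one which is a square up to bad
factors. -/
theorem isSquare_tangent {A B C x₀ y₀ z₀ x y z : GaussianInt}
    (h₀ : A * x₀ ^ 2 = B * y₀ ^ 2 + C * z₀ ^ 2) (h : A * x ^ 2 = B * y ^ 2 + C * z ^ 2)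
    (hA : A * x₀ ∣ 226 ^ 3) (hB : B ∣ 226 ^ 3) (hC : C ∣ 226 ^ 3)
    (hprim : ∀ q, Prime q → q ∣ x → q ∣ y → q ∣ z → q ∣ 226) (φ : GaussianInt →+* ZMod 113) :
    IsSquare (φ (B * y₀ * y + C * z₀ * z + A * x₀ * x)) := by
  set L := B * y₀ * y + C * z₀ * z + A * x₀ * x with hL
  by_cases hL0 : L = 0
  · rw [hL0, map_zero]; exact IsSquare.zero
  have bad : ∀ {d q : GaussianInt}, d ∣ 226 ^ 3 → Prime q → q ∣ d → q ∣ 226 :=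
    fun hd hq hqd => hq.dvd_of_dvd_pow (hqd.trans hd)
  refine SquareUpToBad.isSquare_map (squareUpToBad_of_mul_eq hL0
    (b := B * y₀ * y + C * z₀ * z - A * x₀ * x) (c := -(B * C)) (k := y₀ * z - z₀ * y)
    ?_ ?_ ?_) φ
  · intro q hq hqd
    rcases hq.dvd_or_dvd ((dvd_neg).mp hqd) with h | h
    exacts [bad hB hq h, bad hC hq h]
  · intro q hq h1 h2
    by_contra hbad
    have hx : q ∣ x := by
      have : q ∣ 2 * (A * x₀) * x := by
        convert dvd_sub h1 h2 using 1; rw [hL]; ring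
      rcases hq.dvd_or_dvd this with h | h
      · rcases hq.dvd_or_dvd h with h | h
        · exact absurd (h.trans ⟨113, by norm_num⟩) hbad
        · exact absurd (bad hA hq h) hbad
      · exact h
    have hK : q ∣ B * y₀ * y + C * z₀ * z := by
      convert dvd_sub h1 (hx.mul_left (A * x₀)) using 1; rw [hL]; ring
    have hD : q ∣ y₀ * z - z₀ * y := by
      have h3 : q ∣ (B * C) * (y₀ * z - z₀ * y) ^ 2 := by
        have := (dvd_neg).mpr (h1.mul_right (B * y₀ * y + C * z₀ * z - A * x₀ * x))
        convert this using 1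
        rw [hL]; linear_combination (-A * x ^ 2) * h₀ - (B * y₀ ^ 2 + C * z₀ ^ 2) * h
      rcases hq.dvd_or_dvd h3 with h | h
      · rcases hq.dvd_or_dvd h with h | h
        exacts [absurd (bad hB hq h) hbad, absurd (bad hC hq h) hbad]
      · exact hq.dvd_of_dvd_pow h
    have hAx : ∀ v, q ∣ (A * x₀) * (x₀ * v) → q ∣ v := by
      intro v hv
      rcases hq.dvd_or_dvd hv with h | h
      · exact absurd (bad hA hq h) hbad
      · rcases hq.dvd_or_dvd h with h | h
        · exact absurd (bad hA hq (h.mul_left _)) hbad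
        · exact h
    have hy : q ∣ y := hAx y (by
      convert dvd_sub (hK.mul_left y₀) (hD.mul_left (C * z₀)) using 1
      linear_combination y * h₀)
    have hz : q ∣ z := hAx z (by
      convert dvd_add (hK.mul_left z₀) (hD.mul_left (B * y₀)) using 1
      linear_combination z * h₀)
    exact hbad (hprim q hq hx hy hz)
  · rw [hL]; linear_combination (-A * x ^ 2) * h₀ - (B * y₀ ^ 2 + C * z₀ ^ 2) * h

/-- The two residue maps of the Gaussian integers at the primes above `113`. -/
def residue (r : ZMod 113) (hr : r * r = -1) : GaussianInt →+* ZMod 113 :=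
  Zsqrtd.lift ⟨r, by rw [hr]; norm_num⟩

theorem residue_im (r : ZMod 113) (hr : r * r = -1) : residue r hr im = r := by
  simp [residue, im]

theorem eq_zero_of_isSquare {y c d : ZMod 113} (hc : IsSquare (c * y)) (hd : IsSquare (d * y))
    (h : ¬ IsSquare (c * d)) : y = 0 := by
  by_contra hy
  refine h ?_
  have hcd : c * d = c * y * (d * y) / y ^ 2 := by
    rw [eq_div_iff (pow_ne_zero 2 hy)]
    ring
  rw [hcd]
  exact (hc.mul hd).div (IsSquare.sq y)

theorem SquareUpToBad.exists_exponents_lt_two {a : GaussianInt} (h : SquareUpToBad a) :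
    ∃ e₁ < 2, ∃ e₂ < 2, ∃ e₃ < 2, ∃ e₄ < 2, ∃ n : GaussianInt,
      a = im ^ e₁ * (1 + im) ^ e₂ * (7 + 8 * im) ^ e₃ * (7 - 8 * im) ^ e₄ * n ^ 2 := by
  obtain ⟨e₁, e₂, e₃, e₄, n, rfl⟩ := h
  have key : ∀ (g : GaussianInt) (e : ℕ), g ^ e = g ^ (e % 2) * (g ^ (e / 2)) ^ 2 := by
    intro g e
    rw [← pow_mul, ← pow_add, mul_comm (e / 2), Nat.mod_add_div]
  have lt : ∀ e : ℕ, e % 2 < 2 := fun e => Nat.mod_lt e two_pos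
  refine ⟨e₁ % 2, lt _, e₂ % 2, lt _, e₃ % 2, lt _, e₄ % 2, lt _,
    im ^ (e₁ / 2) * (1 + im) ^ (e₂ / 2) * (7 + 8 * im) ^ (e₃ / 2) * (7 - 8 * im) ^ (e₄ / 2) * n, ?_⟩
  rw [key im e₁, key (1 + im) e₂, key (7 + 8 * im) e₃, key (7 - 8 * im) e₄]
  ring

theorem eq_zero_of_113_mul_sq {c k : ℤ} (h : 113 * c ^ 2 = k ^ 2) : c = 0 := by
  by_contra hc
  have hdvd : c ^ 2 ∣ k ^ 2 := ⟨113, by rw [← h]; ring⟩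
  obtain ⟨j, rfl⟩ := (Int.pow_dvd_pow_iff two_ne_zero).mp hdvd
  have hj : j ^ 2 = 113 := mul_left_cancel₀ (pow_ne_zero 2 hc) (by linear_combination -h)
  have h1 : j ≤ 11 := by nlinarith
  have h2 : -11 ≤ j := by nlinarith
  interval_cases j <;> omega

theorem cast_isCoprime {a b : ℤ} (h : IsCoprime a b) {q : GaussianInt}
    (ha : q ∣ (a : GaussianInt)) (hb : q ∣ (b : GaussianInt)) : IsUnit q := by
  obtain ⟨u, v, huv⟩ := h
  have h1 : (u : GaussianInt) * a + v * b = 1 := by exact_mod_cast huv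
  exact isUnit_of_dvd_one (h1 ▸ dvd_add (ha.mul_left _) (hb.mul_left _))

theorem exists_of_sum_sq_eq_113_mul_sq {a b c : ℤ} (hab : IsCoprime a b) (ha : Odd a)
    (hb : Even b) (h : a ^ 2 + b ^ 2 = 113 * c ^ 2) :
    ∃ n : GaussianInt, (a : GaussianInt) + b * im = (7 + 8 * im) * n ^ 2 ∨
      (a : GaussianInt) + b * im = (7 - 8 * im) * n ^ 2 := by
  have ha0 : a ≠ 0 := by rintro rfl; simp at ha
  have h0 : (a : GaussianInt) + b * im ≠ 0 := by
    intro h0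
    have := add_mul_im_ext (c := 0) (d := 0) (by simpa using h0)
    exact ha0 this.1
  have hc0 : c ≠ 0 := by rintro rfl; nlinarith [sq_nonneg b, sq_pos_of_ne_zero ha0]
  have hcast : (a : GaussianInt) ^ 2 + b ^ 2 = 113 * c ^ 2 := by exact_mod_cast h
  have hbad : SquareUpToBad ((a : GaussianInt) + b * im) := by
    refine squareUpToBad_of_mul_eq h0 (b := a - b * im) (c := 113) (k := c) ?_ ?_ ?_
    · exact fun q _ h => h.trans ⟨2, by norm_num⟩
    · intro q hq h1 h2
      have ha : q ∣ 2 * a := by convert dvd_add h1 h2 using 1; ring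
      have hb : q ∣ 2 * b := by
        convert (dvd_sub h1 h2).mul_left (-im) using 1
        linear_combination (2 * (b : GaussianInt)) * im_sq
      by_contra hq2
      have hq2 : ¬ q ∣ 2 := fun h => hq2 (h.trans ⟨113, by norm_num⟩)
      exact hq.not_isUnit (cast_isCoprime hab ((hq.dvd_or_dvd ha).resolve_left hq2)
        ((hq.dvd_or_dvd hb).resolve_left hq2))
    · linear_combination hcast - (b : GaussianInt) ^ 2 * im_sq
  obtain ⟨e₁, h₁, e₂, h₂, e₃, h₃, e₄, h₄, n, hn⟩ := hbad.exists_exponents_lt_two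
  have hN : a ^ 2 + b ^ 2 = 2 ^ e₂ * 113 ^ e₃ * 113 ^ e₄ * n.norm ^ 2 := by
    have := congrArg Zsqrtd.normMonoidHom hn
    simp only [map_mul, map_pow] at this
    simp [Zsqrtd.normMonoidHom, Zsqrtd.norm, im] at this ⊢
    linarith
  have he₂ : e₂ = 0 := by
    by_contra he
    obtain rfl : e₂ = 1 := by omega
    have hodd : Odd (a ^ 2 + b ^ 2) := ha.pow.add_even (hb.pow_of_ne_zero two_ne_zero)
    rw [hN, pow_one, mul_assoc, mul_assoc] at hodd
    exact (Int.not_odd_iff_even.mpr (even_two_mul _)) hodd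
  subst he₂
  obtain ⟨u, v⟩ := n
  interval_cases e₃ <;> interval_cases e₄
  · exact absurd (eq_zero_of_113_mul_sq (by rw [← h, hN]; ring)) hc0
  · interval_cases e₁
    · exact ⟨⟨u, v⟩, Or.inr (by rw [hn]; ring)⟩
    · exfalso
      have := Zsqrtd.ext_iff.mp hn
      simp [im, pow_two] at this
      rw [Int.odd_iff] at ha
      rw [Int.even_iff] at hb
      obtain ⟨h1, h2⟩ := this
      ring_nf at h1 h2
      omega
  · interval_cases e₁
    · exact ⟨⟨u, v⟩, Or.inl (by rw [hn]; ring)⟩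
    · exfalso
      have := Zsqrtd.ext_iff.mp hn
      simp [im, pow_two] at this
      rw [Int.odd_iff] at ha
      rw [Int.even_iff] at hb
      obtain ⟨h1, h2⟩ := this
      ring_nf at h1 h2
      omega
  · refine absurd (eq_zero_of_113_mul_sq (c := Zsqrtd.norm (⟨u, v⟩ : GaussianInt)) (k := c) ?_) ?_
    · linarith
    · intro h0
      rw [h0] at hN
      nlinarith [sq_nonneg b, sq_pos_of_ne_zero ha0]

theorem exists_of_sum_sq_eq_sq {a b c : ℤ} (hab : IsCoprime a b) (ha : Odd a)
    (h : a ^ 2 + b ^ 2 = c ^ 2) : ∃ n : GaussianInt, (a : GaussianInt) + b * im = n ^ 2 := by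
  have ha0 : a ≠ 0 := by rintro rfl; simp at ha
  have hc : 0 < |c| := by
    rw [abs_pos]; rintro rfl; nlinarith [sq_nonneg b, sq_pos_of_ne_zero ha0]
  have ht : PythagoreanTriple a b |c| := by
    rw [PythagoreanTriple, ← pow_two, ← pow_two, ← pow_two, sq_abs, h]
  obtain ⟨m, n, h1, h2, -⟩ := ht.coprime_classification' (Int.isCoprime_iff_gcd_eq_one.mp hab)
    (Int.odd_iff.mp ha) hc
  refine ⟨m + n * im, ?_⟩
  rw [h1, h2]
  push_cast
  linear_combination (-(n : GaussianInt) ^ 2) * im_sq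

theorem dvd_two_of_dvd_two_mul {a b : ℤ} (h : IsCoprime a b) {q : GaussianInt} (hq : Prime q)
    (ha : q ∣ 2 * (a : GaussianInt)) (hb : q ∣ 2 * (b : GaussianInt)) : q ∣ 2 := by
  rcases hq.dvd_or_dvd ha with h1 | h1
  · exact h1
  · rcases hq.dvd_or_dvd hb with h2 | h2
    · exact h2
    · exact absurd (cast_isCoprime h h1 h2) hq.not_isUnit

theorem cast_ne_zero_of_isCoprime {a b : ℤ} (h : IsCoprime a b) (ha : (a : ZMod 113) = 0)
    (hb : (b : ZMod 113) = 0) : False := by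
  obtain ⟨u, v, huv⟩ := h
  have := congrArg (Int.cast : ℤ → ZMod 113) huv
  push_cast at this
  rw [ha, hb] at this
  revert this
  simp

set_option maxRecDepth 10000 in
theorem false_of_add_sq_of_sub_sq_aux {a b m n : ℤ} (hab : IsCoprime a b)
    (hm : a + b = m ^ 2) (hn : a - b = n ^ 2) {z : GaussianInt}
    (hz : (a : GaussianInt) + b * im = (7 + 8 * im) * z ^ 2) : False := by
  obtain ⟨x, y, rfl⟩ : ∃ x y : ℤ, z = x + y * im := ⟨_, _, eq_add_mul_im z⟩
  obtain ⟨ha, hb⟩ := add_mul_im_ext (a := a) (b := b) (c := 7 * (x ^ 2 - y ^ 2) - 16 * (x * y))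
    (d := 8 * (x ^ 2 - y ^ 2) + 14 * (x * y)) (by
      push_cast
      linear_combination hz + (7 * (y : GaussianInt) ^ 2 + 8 * y ^ 2 * im + 16 * x * y) * im_sq)
  have hmG : (a : GaussianInt) + b = m ^ 2 := by exact_mod_cast hm
  have hnG : (a : GaussianInt) - b = n ^ 2 := by exact_mod_cast hn
  have haG : (a : GaussianInt) = 7 * (x ^ 2 - y ^ 2) - 16 * (x * y) := by exact_mod_cast ha
  have hbG : (b : GaussianInt) = 8 * (x ^ 2 - y ^ 2) + 14 * (x * y) := by exact_mod_cast hb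
  have hmZ : (a : ZMod 113) + b = m ^ 2 := by exact_mod_cast congrArg (Int.cast : ℤ → ZMod 113) hm
  have hnZ : (a : ZMod 113) - b = n ^ 2 := by exact_mod_cast congrArg (Int.cast : ℤ → ZMod 113) hn
  have haZ : (a : ZMod 113) = 7 * (x ^ 2 - y ^ 2) - 16 * (x * y) := by
    exact_mod_cast congrArg (Int.cast : ℤ → ZMod 113) ha
  have hbZ : (b : ZMod 113) = 8 * (x ^ 2 - y ^ 2) + 14 * (x * y) := by
    exact_mod_cast congrArg (Int.cast : ℤ → ZMod 113) hb
  have h113 : (113 : ZMod 113) = 0 := by decide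
  have hsq : ∀ e : ℤ, e ^ 2 = 1 → IsSquare ((y : ZMod 113) - 15 * x + e * n) := by
    intro e he
    have heG : (e : GaussianInt) ^ 2 = 1 := by exact_mod_cast he
    have := isSquare_tangent (A := 1) (B := 1) (C := -226) (x₀ := e) (y₀ := 1) (z₀ := 0)
      (x := n) (y := y - 15 * x) (z := x) (by linear_combination heG)
      (by linear_combination haG - hbG - hnG) (by
        rw [one_mul]; exact ⟨e * 226 ^ 3, by linear_combination (-226 ^ 3) * heG⟩)
      (one_dvd _) ⟨-226 ^ 2, by norm_num⟩ (by
        intro q hq _ h2 h3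
        have h4 : q ∣ (y : GaussianInt) := by
          convert dvd_add h2 (h3.mul_left 15) using 1; ring
        refine absurd (cast_isCoprime hab ?_ ?_) hq.not_isUnit
        · rw [haG]
          convert dvd_add (h3.mul_left (7 * x - 16 * y)) (h4.mul_left (-7 * y)) using 1; ring
        · rw [hbG]
          convert dvd_add (h3.mul_left (8 * x + 14 * y)) (h4.mul_left (-8 * y)) using 1; ring)
      (residue 15 (by decide))
    simp only [map_mul, map_add, map_sub, map_neg, map_one, map_ofNat, map_zero,
      map_intCast] at this
    convert this using 1
    ring
  have hL : ∀ e : ℤ, e ^ 2 = 1 → IsSquare (-17 * (m : ZMod 113) - 645 * e * n) := by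
    intro e he
    have heG : (e : GaussianInt) ^ 2 = 1 := by exact_mod_cast he
    have := isSquare_tangent (A := 15 + im) (B := 1) (C := -im) (x₀ := -1) (y₀ := -2 + im)
      (z₀ := e * (2 + 3 * im)) (x := x + y * im) (y := m) (z := n)
      (by
        have : (15 + im : GaussianInt) * (-1) ^ 2 =
            1 * (-2 + im) ^ 2 + (-im) * (2 + 3 * im) ^ 2 := by
          decide
        linear_combination this + im * (2 + 3 * im) ^ 2 * heG)
      (by
        linear_combination hmG - im * hnG - (1 - im) * hz
          + (8 * (x + y * im) ^ 2 - b) * im_sq)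
      ⟨-(15 - im) * 226 ^ 2, by linear_combination 226 ^ 2 * im_sq⟩
      (one_dvd _) ⟨im * 226 ^ 3, by linear_combination 226 ^ 3 * im_sq⟩ (by
        intro q hq _ h2 h3
        refine (dvd_two_of_dvd_two_mul hab hq ?_ ?_).trans ⟨113, by norm_num⟩
        · convert dvd_add (h2.mul_left (m : GaussianInt)) (h3.mul_left (n : GaussianInt)) using 1
          linear_combination hmG + hnG
        · convert dvd_sub (h2.mul_left (m : GaussianInt)) (h3.mul_left (n : GaussianInt)) using 1
          linear_combination hmG - hnG)
      (residue (-15) (by decide))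
    simp only [map_mul, map_add, map_neg, map_one, map_ofNat, map_intCast, residue_im] at this
    convert this using 1
    ring
  have h1 : (n : ZMod 113) = y - 15 * x ∨ (n : ZMod 113) = -(y - 15 * x) := by
    rw [← sq_eq_sq_iff_eq_or_eq_neg]
    linear_combination haZ - hbZ - hnZ - 2 * x ^ 2 * h113
  have h2 : (m : ZMod 113) = 18 * n ∨ (m : ZMod 113) = -(18 * n) := by
    rw [← sq_eq_sq_iff_eq_or_eq_neg]
    linear_combination 16 * haZ - 14 * hbZ - hmZ - 15 * hnZ - (3 * n ^ 2 + 4 * x * y) * h113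
  have h3 : IsSquare (2 * (n : ZMod 113)) ∨ IsSquare (-2 * (n : ZMod 113)) := by
    rcases h1 with h1 | h1
    · left; convert hsq 1 (by norm_num) using 1; rw [h1]; push_cast; ring
    · right; convert hsq (-1) (by norm_num) using 1; rw [h1]; push_cast; ring
  have h4 : IsSquare (47 * (n : ZMod 113)) ∨ IsSquare (-47 * (n : ZMod 113)) := by
    rcases h2 with h2 | h2
    · right
      convert hL 1 (by norm_num) using 1; rw [h2]; push_cast
      linear_combination 8 * (n : ZMod 113) * h113
    · left
      convert hL (-1) (by norm_num) using 1; rw [h2]; push_cast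
      linear_combination -8 * (n : ZMod 113) * h113
  have hn0 : (n : ZMod 113) = 0 := by
    rcases h3 with h3 | h3 <;> rcases h4 with h4 | h4 <;>
      exact eq_zero_of_isSquare h3 h4 (by decide)
  have hm0 : (m : ZMod 113) = 0 := by simpa [hn0] using h2
  have h2u : (57 : ZMod 113) * 2 = 1 := by decide
  rw [hn0] at hnZ
  rw [hm0] at hmZ
  exact cast_ne_zero_of_isCoprime hab
    (by linear_combination 57 * (hmZ + hnZ) - a * h2u)
    (by linear_combination 57 * (hmZ - hnZ) - b * h2u)

theorem false_of_add_sq_of_sub_sq {a b c m n : ℤ} (hab : IsCoprime a b) (ha : Odd a)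
    (hb : Even b) (h : a ^ 2 + b ^ 2 = 113 * c ^ 2)
    (hm : a + b = m ^ 2) (hn : a - b = n ^ 2) : False := by
  obtain ⟨z, hz | hz⟩ := exists_of_sum_sq_eq_113_mul_sq hab ha hb h
  · exact false_of_add_sq_of_sub_sq_aux hab hm hn hz
  · refine false_of_add_sq_of_sub_sq_aux (b := -b) (m := n) (n := m) (z := star z) hab.neg_right
      (by linarith) (by linarith) ?_
    have := congrArg star hz
    have hs : star im = -im := by decide
    simp only [star_add, star_mul, star_sub, star_intCast, star_pow, star_ofNat, hs] at this
    push_cast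
    linear_combination this

set_option maxRecDepth 10000 in
theorem false_of_add_sq_of_sub_113_mul_sq {a b c m n : ℤ} (hab : IsCoprime a b) (ha : Odd a)
    (h : a ^ 2 + b ^ 2 = c ^ 2) (hm : a + b = m ^ 2) (hn : a - b = 113 * n ^ 2) : False := by
  obtain ⟨z, hz⟩ := exists_of_sum_sq_eq_sq hab ha h
  obtain ⟨x, y, rfl⟩ : ∃ x y : ℤ, z = x + y * im := ⟨_, _, eq_add_mul_im z⟩
  obtain ⟨ha, hb⟩ := add_mul_im_ext (a := a) (b := b) (c := x ^ 2 - y ^ 2) (d := 2 * x * y) (by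
    push_cast
    linear_combination hz + (y : GaussianInt) ^ 2 * im_sq)
  have hmG : (a : GaussianInt) + b = m ^ 2 := by exact_mod_cast hm
  have hnG : (a : GaussianInt) - b = 113 * n ^ 2 := by exact_mod_cast hn
  have haG : (a : GaussianInt) = x ^ 2 - y ^ 2 := by exact_mod_cast ha
  have hbG : (b : GaussianInt) = 2 * x * y := by exact_mod_cast hb
  have hmZ : (a : ZMod 113) + b = m ^ 2 := by exact_mod_cast congrArg (Int.cast : ℤ → ZMod 113) hm
  have hnZ : (a : ZMod 113) - b = 113 * n ^ 2 := by
    exact_mod_cast congrArg (Int.cast : ℤ → ZMod 113) hn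
  have haZ : (a : ZMod 113) = x ^ 2 - y ^ 2 := by
    exact_mod_cast congrArg (Int.cast : ℤ → ZMod 113) ha
  have hbZ : (b : ZMod 113) = 2 * x * y := by exact_mod_cast congrArg (Int.cast : ℤ → ZMod 113) hb
  have h113 : (113 : ZMod 113) = 0 := by decide
  have hsq : IsSquare ((x : ZMod 113) + y + m) := by
    have := isSquare_tangent (A := 1) (B := 1) (C := -2) (x₀ := 1) (y₀ := 1) (z₀ := 0)
      (x := m) (y := x + y) (z := y) (by ring) (by linear_combination haG + hbG - hmG)
      (one_dvd _) (one_dvd _) ⟨-113 * 226 ^ 2, by norm_num⟩ (by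
        intro q hq _ h2 h3
        have h4 : q ∣ (x : GaussianInt) := by
          convert dvd_sub h2 h3 using 1; ring
        refine absurd (cast_isCoprime hab ?_ ?_) hq.not_isUnit
        · rw [haG]
          exact dvd_sub (dvd_pow h4 two_ne_zero) (dvd_pow h3 two_ne_zero)
        · rw [hbG]
          exact h3.mul_left _)
      (residue 15 (by decide))
    simp only [map_mul, map_add, map_neg, map_one, map_ofNat, map_zero, map_intCast] at this
    convert this using 1
    ring
  have hL : ∀ e : ℤ, e ^ 2 = 1 → IsSquare (-49 * e * (m : ZMod 113) - 25 * (x + 15 * y)) := by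
    intro e he
    have heG : (e : GaussianInt) ^ 2 = 1 := by exact_mod_cast he
    have := isSquare_tangent (A := 113 * im) (B := 1) (C := -(1 - im)) (x₀ := -im)
      (y₀ := e * (-4 - 3 * im)) (z₀ := -4 - 9 * im) (x := n) (y := m) (z := x + y * im)
      (by
        have : (113 * im : GaussianInt) * (-im) ^ 2 =
            1 * (-4 - 3 * im) ^ 2 + -(1 - im) * (-4 - 9 * im) ^ 2 := by decide
        linear_combination this - (-4 - 3 * im) ^ 2 * heG)
      (by linear_combination hmG - im * hnG - (1 - im) * hz - b * im_sq)
      ⟨2 * 226 ^ 2, by linear_combination 226 ^ 3 * im_sq⟩ (one_dvd _)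
      ⟨-(1 + im) * 113 * 226 ^ 2, by linear_combination 113 * 226 ^ 2 * im_sq⟩ (by
        intro q hq h1 h2 _
        refine (dvd_two_of_dvd_two_mul hab hq ?_ ?_).trans ⟨113, by norm_num⟩
        · convert dvd_add (h2.mul_left (m : GaussianInt)) (h1.mul_left (113 * n : GaussianInt))
            using 1
          linear_combination hmG + hnG
        · convert dvd_sub (h2.mul_left (m : GaussianInt)) (h1.mul_left (113 * n : GaussianInt))
            using 1
          linear_combination hmG - hnG)
      (residue 15 (by decide))
    simp only [map_mul, map_add, map_sub, map_neg, map_one, map_ofNat, map_intCast,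
      residue_im] at this
    convert this using 1
    linear_combination (225 * n + 17 * (x + 15 * y)) * h113
  have h1 : (x : ZMod 113) = 52 * y ∨ (x : ZMod 113) = 63 * y := by
    have : (x : ZMod 113) - y = 51 * y ∨ (x : ZMod 113) - y = -(51 * y) := by
      rw [← sq_eq_sq_iff_eq_or_eq_neg]
      linear_combination hnZ - haZ + hbZ + (n ^ 2 - 23 * y ^ 2) * h113
    rcases this with h | h
    · left; linear_combination h
    · right; linear_combination h - y * h113
  have hy0 : (y : ZMod 113) = 0 := by
    rcases h1 with h1 | h1
    · have h2 : (m : ZMod 113) = 35 * y ∨ (m : ZMod 113) = -(35 * y) := by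
        rw [← sq_eq_sq_iff_eq_or_eq_neg]
        rw [haZ, hbZ, h1] at hmZ
        linear_combination 14 * y ^ 2 * h113 - hmZ
      rcases h2 with h2 | h2
      · refine eq_zero_of_isSquare (c := 88) (d := -73) ?_ ?_ (by decide)
        · convert hsq using 1; rw [h1, h2]; ring
        · convert hL (-1) (by norm_num) using 1; rw [h1, h2]; push_cast
          linear_combination (-1 : ZMod 113) * y * h113
      · refine eq_zero_of_isSquare (c := 18) (d := -73) ?_ ?_ (by decide)
        · convert hsq using 1; rw [h1, h2]; ring
        · convert hL 1 (by norm_num) using 1; rw [h1, h2]; push_cast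
          linear_combination (-1 : ZMod 113) * y * h113
    · have h2 : (m : ZMod 113) = 34 * y ∨ (m : ZMod 113) = -(34 * y) := by
        rw [← sq_eq_sq_iff_eq_or_eq_neg]
        rw [haZ, hbZ, h1] at hmZ
        linear_combination 26 * y ^ 2 * h113 - hmZ
      rcases h2 with h2 | h2
      · refine eq_zero_of_isSquare (c := 98) (d := 55) ?_ ?_ (by decide)
        · convert hsq using 1; rw [h1, h2]; ring
        · convert hL (-1) (by norm_num) using 1; rw [h1, h2]; push_cast
          linear_combination 3 * y * h113
      · refine eq_zero_of_isSquare (c := 30) (d := 55) ?_ ?_ (by decide)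
        · convert hsq using 1; rw [h1, h2]; ring
        · convert hL 1 (by norm_num) using 1; rw [h1, h2]; push_cast
          linear_combination 3 * y * h113
  have hx0 : (x : ZMod 113) = 0 := by simpa [hy0] using h1
  exact cast_ne_zero_of_isCoprime hab (by simp [haZ, hx0, hy0]) (by simp [hbZ, hy0])

theorem dvd_226_of_dvd_conj {a b : ℤ} (hab : IsCoprime a b) {z z' q : GaussianInt}
    (hz : (a : GaussianInt) + b * im = z ^ 2) (hz' : (a : GaussianInt) - b * im = z' ^ 2)
    (hq : Prime q) (h : q ∣ z) (h' : q ∣ z') : q ∣ 226 := by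
  refine (dvd_two_of_dvd_two_mul hab hq ?_ ?_).trans ⟨113, by norm_num⟩
  · convert dvd_add (h.mul_left z) (h'.mul_left z') using 1
    linear_combination hz + hz'
  · convert (dvd_sub (h.mul_left z) (h'.mul_left z')).mul_left (-im) using 1
    linear_combination -im * (hz - hz') + 2 * b * im_sq

set_option maxRecDepth 10000 in
theorem false_of_sum_sq_pair_aux_left {s t z w : ℤ} (hst : IsCoprime (s - t) t)
    (hω : ((s - t : ℤ) : GaussianInt) + t * im = (z + w * im) ^ 2) {x : GaussianInt}
    (hx : ((s + t : ℤ) : GaussianInt) + t * im = (7 + 8 * im) * x ^ 2) : False := by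
  have hω' : ((s - t : ℤ) : GaussianInt) - t * im = (z - w * im) ^ 2 := by
    have := congrArg star hω
    have hs : star im = -im := by decide
    simp only [star_add, star_mul, star_intCast, star_pow, hs] at this
    linear_combination this
  have hconic : (7 + 8 * im) * x ^ 2 = (1 - im) * (z + w * im) ^ 2 + im * (z - w * im) ^ 2 := by
    rw [← hω, ← hω', ← hx]
    push_cast
    linear_combination (2 * (t : GaussianInt)) * im_sq
  have hL : ∀ e : ℤ, e ^ 2 = 1 → ∀ φ : GaussianInt →+* ZMod 113,
      IsSquare (φ ((-1 + 5 * im) * (z + w * im) + 3 * e * im * (z - w * im)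
        + (8 - 7 * im) * x)) := by
    intro e he φ
    have heG : (e : GaussianInt) ^ 2 = 1 := by exact_mod_cast he
    convert isSquare_tangent (x₀ := -im) (y₀ := -3 + 2 * im) (z₀ := 3 * e) ?_ hconic
      ⟨2 * im * (7 - 8 * im) * 226 ^ 2, ?_⟩ ⟨(1 + im) * 113 * 226 ^ 2, ?_⟩ ⟨-im * 226 ^ 3, ?_⟩
      (fun q hq _ h1 h2 => dvd_226_of_dvd_conj hst hω hω' hq h1 h2) φ using 2
    · linear_combination (8 * x + 2 * (z + w * im)) * im_sq
    · have : (7 + 8 * im) * (-im) ^ 2 = (1 - im) * (-3 + 2 * im) ^ 2 + im * 3 ^ 2 := by decide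
      linear_combination this - 9 * im * heG
    · linear_combination 226 ^ 2 * (226 - 128 * im ^ 2) * im_sq
    · linear_combination 226 ^ 2 * 113 * im_sq
    · linear_combination 226 ^ 3 * im_sq
  set φ₁ := residue 15 (by decide)
  set φ₂ := residue (-15) (by decide)
  have hi₁ : φ₁ im = 15 := residue_im _ _
  have hi₂ : φ₂ im = -15 := residue_im _ _
  have c₁ := congrArg φ₁ hconic
  have c₂ := congrArg φ₂ hconic
  simp only [map_mul, map_add, map_sub, map_pow, map_one, map_ofNat, map_intCast, hi₁, hi₂]
    at c₁ c₂
  have hL₁ := hL 1 (by norm_num) φ₁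
  have hL₂ := fun e he => hL e he φ₂
  simp only [map_mul, map_add, map_sub, map_neg, map_one, map_ofNat, map_intCast, hi₁, hi₂]
    at hL₁ hL₂
  generalize φ₁ x = X at c₁ hL₁
  generalize φ₂ x = Y at c₂ hL₂
  obtain ⟨U, hU⟩ : ∃ U : ZMod 113, z - w * 15 = U := ⟨_, rfl⟩
  obtain ⟨V, hV⟩ : ∃ V : ZMod 113, z + w * 15 = V := ⟨_, rfl⟩
  rw [hU, hV] at c₁ hL₁
  simp only [mul_neg, ← sub_eq_add_neg, sub_neg_eq_add, hU, hV] at c₂ hL₂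
  have hV' : V = 41 * U ∨ V = -(41 * U) := by
    rw [← sq_eq_sq_iff_eq_or_eq_neg]
    linear_combination (norm := (ring_nf; reduce_mod_char)) 98 * c₂
  have hX' : X = 32 * U ∨ X = -(32 * U) := by
    have : V ^ 2 = (41 * U) ^ 2 := by rcases hV' with h | h <;> rw [h]; ring
    rw [← sq_eq_sq_iff_eq_or_eq_neg]
    linear_combination (norm := (ring_nf; reduce_mod_char)) -8 * c₁ - this
  have hU₂ : IsSquare (-39 * U) := by
    rcases hV' with h | h
    · convert hL₂ (-1) (by norm_num) using 1; push_cast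
      linear_combination (norm := (ring_nf; reduce_mod_char)) -45 * h
    · convert hL₂ 1 (by norm_num) using 1; push_cast
      linear_combination (norm := (ring_nf; reduce_mod_char)) 45 * h
  have hU0 : U = 0 := by
    push_cast at hL₁
    rcases hV' with h | h <;> rcases hX' with h' | h'
    · refine eq_zero_of_isSquare (c := 88) ?_ hU₂ (by decide)
      convert hL₁ using 1
      linear_combination (norm := (ring_nf; reduce_mod_char)) -74 * h + 97 * h'
    · refine eq_zero_of_isSquare (c := 194) ?_ hU₂ (by decide)
      convert hL₁ using 1
      linear_combination (norm := (ring_nf; reduce_mod_char)) -74 * h + 97 * h'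
    · refine eq_zero_of_isSquare (c := -104) ?_ hU₂ (by decide)
      convert hL₁ using 1
      linear_combination (norm := (ring_nf; reduce_mod_char)) -74 * h + 97 * h'
    · refine eq_zero_of_isSquare (c := 2) ?_ hU₂ (by decide)
      convert hL₁ using 1
      linear_combination (norm := (ring_nf; reduce_mod_char)) -74 * h + 97 * h'
  have hV0 : V = 0 := by simpa [hU0] using hV'
  have hω₁ := congrArg φ₁ hω
  have hω₂ := congrArg φ₁ hω'
  simp only [map_mul, map_add, map_sub, map_pow, map_intCast, hi₁, hU, hV, hU0, hV0] at hω₁ hω₂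
  exact cast_ne_zero_of_isCoprime hst
    (by linear_combination (norm := (ring_nf; reduce_mod_char)) 57 * (hω₁ + hω₂))
    (by linear_combination (norm := (ring_nf; reduce_mod_char)) 49 * (hω₁ - hω₂))

set_option maxRecDepth 10000 in
theorem false_of_sum_sq_pair_aux_right {s t z w : ℤ} (hst : IsCoprime (s - t) t)
    (hω : ((s - t : ℤ) : GaussianInt) + t * im = (z + w * im) ^ 2) {x : GaussianInt}
    (hx : ((s + t : ℤ) : GaussianInt) + t * im = (7 - 8 * im) * x ^ 2) : False := by
  have hω' : ((s - t : ℤ) : GaussianInt) - t * im = (z - w * im) ^ 2 := by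
    have := congrArg star hω
    have hs : star im = -im := by decide
    simp only [star_add, star_mul, star_intCast, star_pow, hs] at this
    linear_combination this
  have hconic : (7 - 8 * im) * x ^ 2 = (1 - im) * (z + w * im) ^ 2 + im * (z - w * im) ^ 2 := by
    rw [← hω, ← hω', ← hx]
    push_cast
    linear_combination (2 * (t : GaussianInt)) * im_sq
  have hL : ∀ e : ℤ, e ^ 2 = 1 → ∀ φ : GaussianInt →+* ZMod 113,
      IsSquare (φ ((-3 + im) * (z + w * im) - 3 * e * (z - w * im)
        - (7 - 8 * im) * x)) := by
    intro e he φ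
    have heG : (e : GaussianInt) ^ 2 = 1 := by exact_mod_cast he
    convert isSquare_tangent (x₀ := -1) (y₀ := -2 - im) (z₀ := 3 * e * im) ?_ hconic
      ⟨-2 * (7 + 8 * im) * 226 ^ 2, ?_⟩ ⟨(1 + im) * 113 * 226 ^ 2, ?_⟩ ⟨-im * 226 ^ 3, ?_⟩
      (fun q hq _ h1 h2 => dvd_226_of_dvd_conj hst hω hω' hq h1 h2) φ using 2
    · linear_combination (-(z + w * im) - 3 * e * (z - w * im)) * im_sq
    · have : (7 - 8 * im) * (-1) ^ 2 = (1 - im) * (-2 - im) ^ 2 + im * (3 * im) ^ 2 := by decide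
      linear_combination this - 9 * im ^ 3 * heG
    · linear_combination 226 ^ 2 * 128 * im_sq
    · linear_combination 226 ^ 2 * 113 * im_sq
    · linear_combination 226 ^ 3 * im_sq
  set φ₁ := residue 15 (by decide)
  set φ₂ := residue (-15) (by decide)
  have hi₁ : φ₁ im = 15 := residue_im _ _
  have hi₂ : φ₂ im = -15 := residue_im _ _
  have c₁ := congrArg φ₁ hconic
  have c₂ := congrArg φ₂ hconic
  simp only [map_mul, map_add, map_sub, map_pow, map_one, map_ofNat, map_intCast, hi₁, hi₂]
    at c₁ c₂
  have hL₁ := fun e he => hL e he φ₁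
  have hL₂ := hL 1 (by norm_num) φ₂
  simp only [map_mul, map_add, map_sub, map_neg, map_ofNat, map_intCast, hi₁, hi₂]
    at hL₁ hL₂
  generalize φ₁ x = X at c₁ hL₁
  generalize φ₂ x = Y at c₂ hL₂
  obtain ⟨U, hU⟩ : ∃ U : ZMod 113, z - w * 15 = U := ⟨_, rfl⟩
  obtain ⟨V, hV⟩ : ∃ V : ZMod 113, z + w * 15 = V := ⟨_, rfl⟩
  simp only [hU, hV] at c₁ hL₁
  simp only [mul_neg, ← sub_eq_add_neg, sub_neg_eq_add, hU, hV] at c₂ hL₂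
  have hV' : V = 28 * U ∨ V = -(28 * U) := by
    rw [← sq_eq_sq_iff_eq_or_eq_neg]
    linear_combination (norm := (ring_nf; reduce_mod_char)) -8 * c₁
  have hY' : Y = 7 * U ∨ Y = -(7 * U) := by
    have : V ^ 2 = (28 * U) ^ 2 := by rcases hV' with h | h <;> rw [h]; ring
    rw [← sq_eq_sq_iff_eq_or_eq_neg]
    linear_combination (norm := (ring_nf; reduce_mod_char)) -8 * (c₂ - 15 * this)
  have hU₁ : IsSquare (6 * U) ∨ IsSquare (-6 * U) := by
    rcases hV' with h | h
    · right
      convert hL₁ 1 (by norm_num) using 1; push_cast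
      linear_combination (norm := (ring_nf; reduce_mod_char)) -12 * h
    · left
      convert hL₁ (-1) (by norm_num) using 1; push_cast
      linear_combination (norm := (ring_nf; reduce_mod_char)) -12 * h
  have hU₂ : IsSquare (-200 * U) ∨ IsSquare (-4 * U) ∨ IsSquare (-32 * U) ∨ IsSquare (164 * U) := by
    push_cast at hL₂
    rcases hV' with h | h <;> rcases hY' with h' | h'
    · left
      convert hL₂ using 1
      linear_combination (norm := (ring_nf; reduce_mod_char)) 3 * h + 14 * h'
    · right; left
      convert hL₂ using 1
      linear_combination (norm := (ring_nf; reduce_mod_char)) 3 * h + 14 * h'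
    · right; right; left
      convert hL₂ using 1
      linear_combination (norm := (ring_nf; reduce_mod_char)) 3 * h + 14 * h'
    · right; right; right
      convert hL₂ using 1
      linear_combination (norm := (ring_nf; reduce_mod_char)) 3 * h + 14 * h'
  have hU0 : U = 0 := by
    rcases hU₁ with h | h <;> rcases hU₂ with h' | h' | h' | h' <;>
      exact eq_zero_of_isSquare h h' (by decide)
  have hV0 : V = 0 := by simpa [hU0] using hV'
  have hω₁ := congrArg φ₁ hω
  have hω₂ := congrArg φ₁ hω'
  simp only [map_mul, map_add, map_sub, map_pow, map_intCast, hi₁, hU, hV, hU0, hV0] at hω₁ hω₂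
  exact cast_ne_zero_of_isCoprime hst
    (by linear_combination (norm := (ring_nf; reduce_mod_char)) 57 * (hω₁ + hω₂))
    (by linear_combination (norm := (ring_nf; reduce_mod_char)) 49 * (hω₁ - hω₂))

theorem false_of_sum_sq_pair {s t e f : ℤ} (hst : IsCoprime s t) (hs : Odd s) (ht : Even t)
    (he : (s + t) ^ 2 + t ^ 2 = 113 * e ^ 2) (hf : (s - t) ^ 2 + t ^ 2 = f ^ 2) : False := by
  have h₁ : IsCoprime (s + t) t := by simpa using hst.add_mul_left_left 1
  have h₂ : IsCoprime (s - t) t := by simpa [sub_eq_add_neg] using hst.add_mul_left_left (-1)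
  obtain ⟨n, hn⟩ := exists_of_sum_sq_eq_sq h₂ (hs.sub_even ht) hf
  rw [eq_add_mul_im n] at hn
  obtain ⟨x, hx | hx⟩ := exists_of_sum_sq_eq_113_mul_sq h₁ (hs.add_even ht) ht he
  · exact false_of_sum_sq_pair_aux_left h₂ hn hx
  · exact false_of_sum_sq_pair_aux_right h₂ hn hx

theorem exists_sq_of_mul_eq_sq {x y w : ℤ} (hx : 0 < x) (hy : 0 < y) (hxy : IsCoprime x y)
    (h : x * y = w ^ 2) : ∃ u v : ℤ, 0 < u ∧ 0 < v ∧ x = u ^ 2 ∧ y = v ^ 2 := by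
  have key : ∀ {x y : ℤ}, 0 < x → IsCoprime x y → x * y = w ^ 2 → ∃ u : ℤ, 0 < u ∧ x = u ^ 2 := by
    intro x y hx hxy h
    obtain ⟨u, hu | hu⟩ := Int.sq_of_isCoprime hxy h
    · exact ⟨|u|, abs_pos.mpr (by rintro rfl; simp at hu; omega), by rw [sq_abs, hu]⟩
    · nlinarith [sq_nonneg u]
  obtain ⟨u, hu, hxu⟩ := key hx hxy h
  obtain ⟨v, hv, hyv⟩ := key hy hxy.symm (by rw [mul_comm, h])
  exact ⟨u, v, hu, hv, hxu, hyv⟩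

theorem exists_sq_of_mul_eq_113_mul_sq {x y w : ℤ} (hx : 0 < x) (hy : 0 < y)
    (hxy : IsCoprime x y) (h : x * y = 113 * w ^ 2) :
    ∃ u v : ℤ, 0 < u ∧ 0 < v ∧ (x = 113 * u ^ 2 ∧ y = v ^ 2 ∨ x = u ^ 2 ∧ y = 113 * v ^ 2) := by
  have hp : Prime (113 : ℤ) := Int.prime_iff_natAbs_prime.mpr (by norm_num)
  rcases hp.dvd_or_dvd (⟨w ^ 2, h⟩ : (113 : ℤ) ∣ x * y) with ⟨t, rfl⟩ | ⟨t, rfl⟩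
  · obtain ⟨u, v, hu, hv, rfl, rfl⟩ := exists_sq_of_mul_eq_sq (w := w) (by omega) hy
      hxy.of_mul_left_right (by linarith)
    exact ⟨u, v, hu, hv, Or.inl ⟨rfl, rfl⟩⟩
  · obtain ⟨u, v, hu, hv, rfl, rfl⟩ := exists_sq_of_mul_eq_sq (w := w) hx (by omega)
      hxy.of_mul_right_right (by linarith)
    exact ⟨u, v, hu, hv, Or.inr ⟨rfl, rfl⟩⟩

theorem isCoprime_two_of_odd {n : ℤ} (h : Odd n) : IsCoprime n 2 := by
  obtain ⟨k, rfl⟩ := h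
  exact ⟨1, -k, by ring⟩

theorem odd_of_isCoprime_of_even {x y : ℤ} (h : IsCoprime x y) (hy : Even y) : Odd x := by
  by_contra hx
  rw [Int.not_odd_iff_even] at hx
  have := h.isUnit_of_dvd' hx.two_dvd hy.two_dvd
  rw [Int.isUnit_iff] at this
  omega

theorem isCoprime_add_sub {a b : ℤ} (hab : IsCoprime a b) (h : Odd (a + b)) :
    IsCoprime (a + b) (a - b) := by
  have h1 : IsCoprime (a + b) b := by simpa using hab.add_mul_left_left 1
  have h2 := ((isCoprime_two_of_odd h).mul_right h1).neg_right.add_mul_left_right 1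
  rwa [show -(2 * b) + (a + b) * 1 = a - b by ring] at h2

theorem isCoprime_mul_add_mul_sub {r s : ℤ} (h : IsCoprime r s) :
    IsCoprime (r * s) ((r + s) * (r - s)) := by
  refine IsCoprime.mul_left (IsCoprime.mul_right ?_ ?_) (IsCoprime.mul_right ?_ ?_)
  · simpa [add_comm] using h.add_mul_left_right 1
  · simpa [add_comm, sub_eq_add_neg] using h.neg_right.add_mul_left_right 1
  · simpa [add_comm] using h.symm.add_mul_left_right 1
  · simpa [add_comm, sub_eq_add_neg] using h.symm.add_mul_left_right (-1)

theorem odd_even_of_sq_sub_sq {a b d k : ℤ} (h : a ^ 2 - b ^ 2 = k * d ^ 2) (hk : k % 4 = 1)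
    (hab : Odd (a + b)) : Odd a ∧ Even b := by
  rcases Int.even_or_odd' a with ⟨a, rfl | rfl⟩ <;> rcases Int.even_or_odd' b with ⟨b, rfl | rfl⟩
  · exfalso; rw [Int.odd_iff] at hab; omega
  · exfalso
    have h4 := congrArg (· % 4) h
    have hd : d ^ 2 % 4 = 0 ∨ d ^ 2 % 4 = 1 := by
      rcases Int.even_or_odd' d with ⟨d, rfl | rfl⟩ <;> ring_nf <;> omega
    have hkd : k * d ^ 2 % 4 = d ^ 2 % 4 := by rw [Int.mul_emod, hk]; simp
    simp only [hkd] at h4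
    ring_nf at h4
    ring_nf at hd
    omega
  · exact ⟨odd_two_mul_add_one a, even_two_mul b⟩
  · exfalso; rw [Int.odd_iff] at hab; omega

theorem exists_of_add_sq_of_sub_sq {r s c d : ℤ} (hs : 0 < s) (hrs : IsCoprime r s)
    (hodd : Odd (r + s)) (hc0 : 0 < c) (hc : r + s = c ^ 2) (hd : r - s = d ^ 2) :
    ∃ g h : ℤ, 0 < g ∧ 0 < h ∧ IsCoprime g h ∧ g ^ 2 + h ^ 2 = r ∧ 2 * (g * h) = s := by
  have hcd := isCoprime_add_sub hrs hodd
  rw [hc, hd, IsCoprime.pow_iff two_pos two_pos] at hcd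
  have hco : Odd c := by rw [hc] at hodd; exact (Int.odd_pow.mp hodd).resolve_right two_ne_zero
  have hdo : Odd d := by
    have : Odd (d ^ 2) := by rw [← hd]; rw [Int.odd_iff] at hodd ⊢; omega
    exact (Int.odd_pow.mp this).resolve_right two_ne_zero
  obtain ⟨c, rfl⟩ := hco
  obtain ⟨d, rfl⟩ := hdo
  obtain ⟨u, v, huv⟩ := hcd
  have hgh : 2 * ((c + d + 1) * (c - d)) = s := by linarith
  have hpos : 0 < (c + d + 1) * (c - d) := by omega
  have h1 : 0 < c + d + 1 ∧ 0 < c - d := by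
    rcases mul_pos_iff.mp hpos with h | h
    · exact h
    · omega
  exact ⟨c + d + 1, c - d, h1.1, h1.2, ⟨u + v, u - v, by linear_combination huv⟩, by linarith, hgh⟩

theorem false_of_quartic {s t a : ℤ} (hst : IsCoprime s t) (hs : Odd s)
    (h : s ^ 4 + 4 * t ^ 4 = 113 * a ^ 2) : False := by
  have hP : ∀ t : ℤ, 0 < (s + t) ^ 2 + t ^ 2 := by
    intro t
    by_cases ht : t = 0
    · have : s ≠ 0 := by rintro rfl; simp at hs
      subst ht; simp; positivity
    · positivity
  have heven : ∀ t e f : ℤ, (s + t) ^ 2 + t ^ 2 = 113 * e ^ 2 → (s - t) ^ 2 + t ^ 2 = f ^ 2 →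
      Even t := by
    intro t e f he hf
    by_contra ht
    rw [Int.not_even_iff_odd] at ht
    have he' : Odd (e ^ 2) := by
      have : Odd (113 * e ^ 2) := by
        rw [← he]; exact (hs.add_odd ht).pow_of_ne_zero two_ne_zero |>.add_odd ht.pow
      exact (Int.odd_mul.mp this).2
    have hf' : Odd (f ^ 2) := by
      rw [← hf]; exact (hs.sub_odd ht).pow_of_ne_zero two_ne_zero |>.add_odd ht.pow
    obtain ⟨i, hi⟩ := Int.eight_dvd_sq_sub_one_of_odd
      ((Int.odd_pow.mp he').resolve_right two_ne_zero)
    obtain ⟨j, hj⟩ := Int.eight_dvd_sq_sub_one_of_odd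
      ((Int.odd_pow.mp hf').resolve_right two_ne_zero)
    obtain ⟨k, hk⟩ := hs.mul ht
    have : 4 * (s * t) = 113 * e ^ 2 - f ^ 2 := by linear_combination he - hf
    omega
  have hodd : Odd ((s + t) ^ 2 + t ^ 2) := by
    have := (hs.pow (n := 2)).add_even (even_two_mul (s * t + t ^ 2))
    convert this using 1
    ring
  have h₂ := isCoprime_two_of_odd hodd
  have hs' : IsCoprime ((s + t) ^ 2 + t ^ 2) s := by
    rw [show (s + t) ^ 2 + t ^ 2 = 2 * t ^ 2 + s * (s + 2 * t) by ring]
    exact (((isCoprime_two_of_odd hs).mul_right hst.pow_right).add_mul_left_right _).symm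
  have ht' : IsCoprime ((s + t) ^ 2 + t ^ 2) t := by
    rw [show (s + t) ^ 2 + t ^ 2 = s ^ 2 + t * (2 * s + 2 * t) by ring]
    exact (hst.symm.pow_right.add_mul_left_right _).symm
  have hcop : IsCoprime ((s + t) ^ 2 + t ^ 2) ((s + -t) ^ 2 + (-t) ^ 2) := by
    rw [show (s + -t) ^ 2 + (-t) ^ 2 = -(2 * 2 * (s * t)) + ((s + t) ^ 2 + t ^ 2) * 1 by ring]
    exact (((h₂.mul_right h₂).mul_right (hs'.mul_right ht')).neg_right).add_mul_left_right 1
  obtain ⟨e, f, -, -, ⟨he, hf⟩ | ⟨hf, he⟩⟩ := exists_sq_of_mul_eq_113_mul_sq (w := a)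
    (hP t) (hP (-t)) hcop (by linarith)
  · have hf : (s - t) ^ 2 + t ^ 2 = f ^ 2 := by linarith
    exact false_of_sum_sq_pair hst hs (heven t e f he hf) he hf
  · have hf : (s - -t) ^ 2 + (-t) ^ 2 = e ^ 2 := by linarith
    exact false_of_sum_sq_pair hst.neg_right hs (heven (-t) f e he hf) he hf

theorem false_of_odd_even_legs {g h a b : ℤ} (hg : 0 < g) (hh : 0 < h) (hgh : IsCoprime g h)
    (hodd : Odd g) (heven : Even h) (hb : g * h = 2 * b ^ 2) (ha : g ^ 2 + h ^ 2 = 113 * a ^ 2) :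
    False := by
  obtain ⟨h, rfl⟩ := heven.exists_two_nsmul
  simp only [nsmul_eq_mul, Nat.cast_ofNat] at *
  obtain ⟨s, t, -, -, rfl, rfl⟩ := exists_sq_of_mul_eq_sq (w := b) hg (by omega : 0 < h)
    hgh.of_mul_right_right (by linarith)
  exact false_of_quartic ((IsCoprime.pow_iff two_pos two_pos).mp hgh.of_mul_right_right)
    ((Int.odd_pow.mp hodd).resolve_right two_ne_zero) (a := a) (by linear_combination ha)

theorem exists_generators_of_odd {x y z v : ℤ} (hx : 0 < x) (hy : 0 < y) (hxy : IsCoprime x y)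
    (hodd : Odd x) (h : x ^ 2 + y ^ 2 = z ^ 2) (hv : x * y = 226 * v ^ 2) :
    ∃ r s : ℤ, 0 < s ∧ s < r ∧ IsCoprime r s ∧ Odd (r + s) ∧
      r * s * (r ^ 2 - s ^ 2) = 113 * v ^ 2 := by
  have hz : 0 < |z| := by
    rw [abs_pos]; rintro rfl; nlinarith
  have ht : PythagoreanTriple x y |z| := by
    rw [PythagoreanTriple, ← pow_two, ← pow_two, ← pow_two, sq_abs, h]
  obtain ⟨m, n, rfl, rfl, -, hmn, hpar, hm⟩ := ht.coprime_classification'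
    (Int.isCoprime_iff_gcd_eq_one.mp hxy) (Int.odd_iff.mp hodd) hz
  have hn : 0 < n := pos_of_mul_pos_right hy (by omega)
  exact ⟨m, n, hn, lt_of_pow_lt_pow_left₀ 2 hm (by omega), Int.isCoprime_iff_gcd_eq_one.mpr hmn,
    by rw [Int.odd_iff]; omega, by linarith⟩

theorem exists_generators {x y z v : ℤ} (hx : 0 < x) (hy : 0 < y) (hxy : IsCoprime x y)
    (h : x ^ 2 + y ^ 2 = z ^ 2) (hv : x * y = 226 * v ^ 2) :
    ∃ r s : ℤ, 0 < s ∧ s < r ∧ IsCoprime r s ∧ Odd (r + s) ∧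
      r * s * (r ^ 2 - s ^ 2) = 113 * v ^ 2 := by
  rcases Int.even_or_odd x with hx2 | hx2
  · exact exists_generators_of_odd hy hx hxy.symm (odd_of_isCoprime_of_even hxy.symm hx2) (z := z)
      (by linarith) (by linarith)
  · exact exists_generators_of_odd hx hy hxy hx2 h hv

theorem infinite_descent (k : ℕ) : ∀ r s w : ℤ, w.natAbs = k → 0 < s → s < r → IsCoprime r s →
    Odd (r + s) → r * s * (r ^ 2 - s ^ 2) = 113 * w ^ 2 → False := by
  induction k using Nat.strong_induction_on with | _ k ih
  rintro r s w rfl hs hsr hrs hodd h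
  have hcs := isCoprime_mul_add_mul_sub hrs
  have hcs' := isCoprime_add_sub hrs hodd
  have hr : 0 < r := hs.trans hsr
  obtain ⟨u, v, -, -, ⟨h1, h2⟩ | ⟨h1, h2⟩⟩ := exists_sq_of_mul_eq_113_mul_sq (w := w)
    (mul_pos hr hs) (mul_pos (by omega : 0 < r + s) (by omega : 0 < r - s)) hcs (by linarith)
  · obtain ⟨c, d, hc0, hd0, hc, hd⟩ := exists_sq_of_mul_eq_sq (by omega) (by omega) hcs' h2
    obtain ⟨g, h', hg, hh', hgh, hsq, hprod⟩ := exists_of_add_sq_of_sub_sq hs hrs hodd hc0 hc hd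
    obtain ⟨a, b, ha0, hb0, ⟨ha, hb⟩ | ⟨ha, hb⟩⟩ := exists_sq_of_mul_eq_113_mul_sq hr hs hrs h1
    · have hbe : Even b := by
        have : Even (b ^ 2) := by rw [← hb, ← hprod]; exact even_two_mul _
        exact (Int.even_pow.mp this).1
      obtain ⟨b, rfl⟩ := hbe
      have hb' : g * h' = 2 * b ^ 2 := by linarith
      rcases Int.even_or_odd g with hg2 | hg2
      · refine false_of_odd_even_legs hh' hg hgh.symm ?_ hg2 (b := b) (a := a) (by linarith)
          (by linarith)
        exact odd_of_isCoprime_of_even hgh.symm hg2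
      · refine false_of_odd_even_legs hg hh' hgh hg2 ?_ hb' (a := a) (by linarith)
        have : Even (g * h') := hb' ▸ even_two_mul _
        exact (Int.even_mul.mp this).resolve_left (Int.not_even_iff_odd.mpr hg2)
    · have hbe : Even b := by
        have : Even (b ^ 2) := by
          rw [Int.even_iff]; omega
        exact (Int.even_pow.mp this).1
      obtain ⟨b, rfl⟩ := hbe
      obtain ⟨r', s', hs', hsr', hrs', hodd', h''⟩ := exists_generators (v := b) hg hh' hgh
        (by rw [hsq, ha]) (by linarith)
      refine ih b.natAbs ?_ r' s' b rfl hs' hsr' hrs' hodd' h''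
      rw [Int.natAbs_lt_iff_sq_lt]
      have hw : w ^ 2 = a ^ 2 * (c ^ 2 * d ^ 2) * (b + b) ^ 2 := by
        rw [← hc, ← hd, ← ha]
        refine mul_left_cancel₀ (by norm_num : (113 : ℤ) ≠ 0) ?_
        linear_combination (r * (r ^ 2 - s ^ 2)) * hb - h
      have : 0 < a ^ 2 * (c ^ 2 * d ^ 2) := by positivity
      rw [hw]
      nlinarith
  · obtain ⟨a, b, ha0, hb0, ha, hb⟩ := exists_sq_of_mul_eq_sq hr hs hrs h1
    have hba : b < a := lt_of_pow_lt_pow_left₀ 2 ha0.le (by omega)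
    have hab : IsCoprime a b := by
      rwa [ha, hb, IsCoprime.pow_iff two_pos two_pos] at hrs
    have habo : Odd (a + b) := by
      rw [ha, hb] at hodd
      simpa [parity_simps] using hodd
    have hab' := isCoprime_add_sub hab habo
    obtain ⟨c, d, hc0, hd0, ⟨hc, hd⟩ | ⟨hc, hd⟩⟩ :=
      exists_sq_of_mul_eq_113_mul_sq (by omega) (by omega) hcs' h2
    · obtain ⟨m, n, -, -, hm, hn⟩ := exists_sq_of_mul_eq_sq (w := d) (by omega) (by omega) hab'
        (by linarith)
      obtain ⟨hao, hbe⟩ := odd_even_of_sq_sub_sq (a := a) (b := b) (d := d) (k := 1) (by linarith)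
        (by norm_num) habo
      exact false_of_add_sq_of_sub_sq (c := c) hab hao hbe (by linarith) hm hn
    · obtain ⟨hao, -⟩ := odd_even_of_sq_sub_sq (a := a) (b := b) (d := d) (k := 113) (by linarith)
        (by norm_num) habo
      obtain ⟨m, n, -, -, ⟨hm, hn⟩ | ⟨hm, hn⟩⟩ := exists_sq_of_mul_eq_113_mul_sq (w := d)
        (by omega) (by omega) hab' (by linarith)
      · exact false_of_add_sq_of_sub_113_mul_sq (c := c) (m := n) (n := m) hab.neg_right hao
          (by linarith) (by linarith) (by linarith)
      · exact false_of_add_sq_of_sub_113_mul_sq (c := c) hab hao (by linarith) hm hn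

theorem false_of_sq_add_sq_of_mul_eq {x y z d : ℤ} (hx : 0 < x) (hy : 0 < y)
    (h : x ^ 2 + y ^ 2 = z ^ 2) (hd : x * y = 226 * d ^ 2) : False := by
  obtain ⟨g, x, y, hg, hxy, rfl, rfl⟩ := Int.exists_gcd_one' (Int.gcd_pos_of_ne_zero_left y hx.ne')
  have hg' : (0 : ℤ) < g := by exact_mod_cast hg
  have hx' : 0 < x := pos_of_mul_pos_left hx hg'.le
  have hy' : 0 < y := pos_of_mul_pos_left hy hg'.le
  obtain ⟨z, rfl⟩ : (g : ℤ) ∣ z := by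
    rw [← Int.pow_dvd_pow_iff two_ne_zero, ← h]
    exact ⟨x ^ 2 + y ^ 2, by ring⟩
  obtain ⟨k, hk⟩ : (g : ℤ) ∣ 226 * d := by
    rw [← Int.pow_dvd_pow_iff two_ne_zero]
    exact ⟨226 * (x * y), by linear_combination -226 * hd⟩
  have hk2 : k ^ 2 = 226 * (x * y) := by
    refine mul_left_cancel₀ (pow_ne_zero 2 hg'.ne') ?_
    linear_combination -226 * hd - (g * k + 226 * d) * hk
  obtain ⟨k, rfl⟩ : (226 : ℤ) ∣ k := by
    have hp : Prime (113 : ℤ) := Int.prime_iff_natAbs_prime.mpr (by norm_num)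
    have h1 := hp.dvd_of_dvd_pow (⟨2 * (x * y), by rw [hk2]; ring⟩ : (113 : ℤ) ∣ k ^ 2)
    have h2 := Int.prime_two.dvd_of_dvd_pow (⟨113 * (x * y), by rw [hk2]; ring⟩ : (2 : ℤ) ∣ k ^ 2)
    omega
  obtain ⟨r, s, hs, hsr, hrs, hodd, h'⟩ := exists_generators (z := z) (v := k) hx' hy'
    (Int.isCoprime_iff_gcd_eq_one.mpr hxy)
    (mul_left_cancel₀ (pow_ne_zero 2 hg'.ne') (by linear_combination h)) (by linarith)
  exact infinite_descent _ r s k rfl hs hsr hrs hodd h'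

end NotCongruent113

/-- `113` is not a congruent number: it is not the area of any right triangle with
rational side lengths. -/
theorem not_congruent_113 :
    ¬ ∃ a b c : ℚ, 0 < a ∧ 0 < b ∧ 0 < c ∧ a ^ 2 + b ^ 2 = c ^ 2 ∧ a * b / 2 = 113 := by
  rintro ⟨a, b, c, ha, hb, -, h, hab⟩
  have hn : ∀ q : ℚ, (q.num : ℚ) = q * q.den := fun q => (Rat.mul_den_eq_num q).symm
  refine NotCongruent113.false_of_sq_add_sq_of_mul_eq (x := a.num * b.den * c.den)
    (y := b.num * a.den * c.den) (z := c.num * a.den * b.den) (d := a.den * b.den * c.den)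
    ?_ ?_ ?_ ?_
  · have := Rat.num_pos.mpr ha
    have := b.den_pos
    have := c.den_pos
    positivity
  · have := Rat.num_pos.mpr hb
    have := a.den_pos
    have := c.den_pos
    positivity
  · qify
    rw [hn, hn, hn]
    linear_combination (a.den * b.den * c.den : ℚ) ^ 2 * h
  · qify
    rw [hn, hn]
    linear_combination 2 * (a.den * b.den * c.den : ℚ) ^ 2 * hab
end
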